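/- Suppose α ≥ 1, n ≥ 2, and λ ≠ ρ are partitions of n with M_α(λ,ρ) ≠ 0. Then |W_α(ρ) − W_α(λ)| ≤ (α·(λ_1 + 1) + λ'_1 + 1)/√(α·C(n,2)), where λ_1 is the largest part of λ and λ'_1 is the number of parts of λ. -/

import Mathlib

open Finset

namespace JackTest

def colLen {n : ℕ} (lam : n.Partition) (j : ℕ) : ℕ :=
  (lam.parts.filter (fun p => j < p)).card

def rowLen {n : ℕ} (lam : n.Partition) (i : ℕ) : ℕ :=
  ((Finset.range n).filter (fun j => i < colLen lam j)).card

def cells {n : ℕ} (lam : n.Partition) : Finset (ℕ × ℕ) :=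
  (Finset.range n ×ˢ Finset.range n).filter (fun s => s.2 < rowLen lam s.1)

def arm {n : ℕ} (lam : n.Partition) (s : ℕ × ℕ) : ℕ := rowLen lam s.1 - (s.2 + 1)

def leg {n : ℕ} (lam : n.Partition) (s : ℕ × ℕ) : ℕ := colLen lam s.2 - (s.1 + 1)

noncomputable def cLow (α : ℝ) {n : ℕ} (lam : n.Partition) : ℝ :=
  ∏ s ∈ cells lam, (α * arm lam s + leg lam s + 1)

noncomputable def cUp (α : ℝ) {n : ℕ} (lam : n.Partition) : ℝ :=
  ∏ s ∈ cells lam, (α * arm lam s + leg lam s + α)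

noncomputable def jackP (α : ℝ) {n : ℕ} (lam : n.Partition) : ℝ :=
  α ^ n * (n.factorial) / (cLow α lam * cUp α lam)

def nStat {n : ℕ} (lam : n.Partition) : ℕ := ∑ i ∈ Finset.range n, i * rowLen lam i

def nStatConj {n : ℕ} (lam : n.Partition) : ℕ := ∑ j ∈ Finset.range n, j * colLen lam j

noncomputable def W (α : ℝ) {n : ℕ} (lam : n.Partition) : ℝ :=
  (α * nStatConj lam - nStat lam) / Real.sqrt (α * n.choose 2)

noncomputable def Phi (x : ℝ) : ℝ :=
  (Real.sqrt (2 * Real.pi))⁻¹ * ∫ t in Set.Iic x, Real.exp (-t ^ 2 / 2)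

/-- `ψ'_{λ/τ}(α)`: zero unless `τ ⊆ λ` (the sizes `|λ| = |τ| + 1` are enforced by the types);
otherwise the product over boxes in the columns of `λ` meeting `λ - τ` but not in the rows
of `λ` meeting `λ - τ`. -/
noncomputable def psi' (α : ℝ) {n : ℕ} (lam : n.Partition) (tau : (n - 1).Partition) : ℝ :=
  if cells tau ⊆ cells lam then
    ∏ s ∈ ((cells lam).filter fun s => ∃ t ∈ cells lam \ cells tau, s.2 = t.2) \
        ((cells lam).filter fun s => ∃ t ∈ cells lam \ cells tau, s.1 = t.1),
      (α * arm lam s + leg lam s + 1) / (α * arm lam s + leg lam s + α) *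
        ((α * arm tau s + leg tau s + α) / (α * arm tau s + leg tau s + 1))
  else 0

/-- The Markov chain `M_α` on partitions of `n`. -/
noncomputable def M (α : ℝ) {n : ℕ} (lam rho : n.Partition) : ℝ :=
  cUp α lam / (α * n * cLow α rho) *
    ∑ tau : (n - 1).Partition, psi' α lam tau * psi' α rho tau * cLow α tau / cUp α tau


theorem colLen_anti {n : ℕ} (lam : n.Partition) : Antitone (colLen lam) := fun _ _ hjk =>
  Multiset.card_le_card (Multiset.monotone_filter_right _ fun _ hp => lt_of_le_of_lt hjk hp)

theorem colLen_le {n : ℕ} (lam : n.Partition) (j : ℕ) : colLen lam j ≤ n := by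
  have hcard : lam.parts.card • 1 ≤ lam.parts.sum :=
    Multiset.card_nsmul_le_sum fun _ hp => lam.parts_pos hp
  have hfilter : colLen lam j ≤ lam.parts.card :=
    Multiset.card_le_card (Multiset.filter_le _ _)
  rw [lam.parts_sum, smul_eq_mul, mul_one] at hcard
  exact hfilter.trans hcard

theorem lt_of_lt_colLen {n : ℕ} (lam : n.Partition) {i j : ℕ} (h : i < colLen lam j) : j < n := by
  obtain ⟨p, hp⟩ := Multiset.card_pos_iff_exists_mem.mp (Nat.zero_lt_of_lt h)
  obtain ⟨hp, hjp⟩ := Multiset.mem_filter.mp hp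
  have hpn := Multiset.le_sum_of_mem hp
  rw [lam.parts_sum] at hpn
  exact lt_of_lt_of_le hjp hpn

theorem rowLen_le {n : ℕ} (lam : n.Partition) (i : ℕ) : rowLen lam i ≤ n :=
  (Finset.card_filter_le _ _).trans (Finset.card_range n).le

theorem lt_rowLen_iff {n : ℕ} (lam : n.Partition) {i j : ℕ} :
    j < rowLen lam i ↔ i < colLen lam j := by
  constructor
  · intro h
    by_contra hij
    refine absurd h (not_lt.mpr ?_)
    calc rowLen lam i ≤ (Finset.range j).card := Finset.card_le_card fun k hk => by
          by_contra hkj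
          exact hij (lt_of_lt_of_le (Finset.mem_filter.mp hk).2
            (colLen_anti lam (not_lt.mp (mt Finset.mem_range.mpr hkj))))
      _ = j := Finset.card_range j
  · intro h
    have hsub : Finset.range (j + 1) ⊆ (Finset.range n).filter fun k => i < colLen lam k := by
      intro k hk
      have hik := lt_of_lt_of_le h (colLen_anti lam (Nat.lt_succ_iff.mp (Finset.mem_range.mp hk)))
      exact Finset.mem_filter.mpr ⟨Finset.mem_range.mpr (lt_of_lt_colLen lam hik), hik⟩
    simpa [rowLen, Nat.succ_le_iff] using Finset.card_le_card hsub

theorem mem_cells_iff {n : ℕ} (lam : n.Partition) {i j : ℕ} :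
    (i, j) ∈ cells lam ↔ i < colLen lam j := by
  simp only [cells, Finset.mem_filter, Finset.mem_product, Finset.mem_range, lt_rowLen_iff]
  exact ⟨And.right, fun h => ⟨⟨lt_of_lt_of_le h (colLen_le lam j), lt_of_lt_colLen lam h⟩, h⟩⟩

theorem mem_cells_of_le {n : ℕ} (lam : n.Partition) {i j k l : ℕ} (h : (i, j) ∈ cells lam)
    (hk : k ≤ i) (hl : l ≤ j) : (k, l) ∈ cells lam := by
  rw [mem_cells_iff] at h ⊢
  exact lt_of_le_of_lt hk (lt_of_lt_of_le h (colLen_anti lam hl))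

theorem card_range_filter_lt {m n : ℕ} (h : m ≤ n) :
    ((Finset.range n).filter fun k => k < m).card = m := by
  have : (Finset.range n).filter (fun k => k < m) = Finset.range m := by
    ext k
    simp only [Finset.mem_filter, Finset.mem_range]
    omega
  rw [this, Finset.card_range]

theorem sum_cells_fst {n : ℕ} (lam : n.Partition) (f : ℕ → ℕ) :
    ∑ s ∈ cells lam, f s.1 = ∑ i ∈ Finset.range n, f i * rowLen lam i := by
  rw [cells, Finset.sum_filter, Finset.sum_product]
  refine Finset.sum_congr rfl fun i _ => ?_
  dsimp only
  rw [← Finset.sum_filter, Finset.sum_const, card_range_filter_lt (rowLen_le lam i), smul_eq_mul,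
    mul_comm]

theorem sum_cells_snd {n : ℕ} (lam : n.Partition) (f : ℕ → ℕ) :
    ∑ s ∈ cells lam, f s.2 = ∑ j ∈ Finset.range n, f j * colLen lam j := by
  rw [cells, Finset.sum_filter, Finset.sum_product_right]
  refine Finset.sum_congr rfl fun j _ => ?_
  simp only [lt_rowLen_iff]
  rw [← Finset.sum_filter, Finset.sum_const, card_range_filter_lt (colLen_le lam j), smul_eq_mul,
    mul_comm]

theorem sum_card_filter_lt (n : ℕ) (s : Multiset ℕ) (hs : ∀ p ∈ s, p ≤ n) :
    ∑ j ∈ Finset.range n, (s.filter fun p => j < p).card = s.sum := by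
  induction s using Multiset.induction with
  | empty => simp
  | cons p s ih =>
    have hp := card_range_filter_lt (hs p (Multiset.mem_cons_self p s))
    rw [Finset.card_filter] at hp
    rw [Multiset.sum_cons, ← ih fun q hq => hs q (Multiset.mem_cons_of_mem hq)]
    conv_rhs => rw [← hp]
    rw [← Finset.sum_add_distrib]
    refine Finset.sum_congr rfl fun j _ => ?_
    by_cases hj : j < p <;> simp [hj, add_comm]

theorem card_cells {n : ℕ} (lam : n.Partition) : (cells lam).card = n := by
  have h := sum_cells_snd lam fun _ => 1
  simp only [Finset.sum_const, smul_eq_mul, mul_one, one_mul] at h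
  rw [h]
  refine (sum_card_filter_lt n lam.parts fun p hp => ?_).trans lam.parts_sum
  exact lam.parts_sum ▸ Multiset.le_sum_of_mem hp

theorem nStat_eq_sum_cells {n : ℕ} (lam : n.Partition) : nStat lam = ∑ s ∈ cells lam, s.1 :=
  (sum_cells_fst lam id).symm

theorem nStatConj_eq_sum_cells {n : ℕ} (lam : n.Partition) :
    nStatConj lam = ∑ s ∈ cells lam, s.2 :=
  (sum_cells_snd lam id).symm

theorem exists_cells_eq_insert {n : ℕ} (hn : 0 < n) (lam : n.Partition) (tau : (n - 1).Partition)
    (h : cells tau ⊆ cells lam) :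
    ∃ i j, (i, j) ∉ cells tau ∧ cells lam = insert (i, j) (cells tau) := by
  have hcard : (cells lam).card = (cells tau).card + 1 := by
    rw [card_cells, card_cells]
    omega
  obtain ⟨⟨i, j⟩, hij, heq⟩ := Finset.exists_eq_insert_iff.mpr ⟨h, hcard.symm⟩
  exact ⟨i, j, hij, heq.symm⟩

theorem nStat_eq_add {n : ℕ} {lam : n.Partition} {tau : (n - 1).Partition} {i j : ℕ}
    (hij : (i, j) ∉ cells tau) (h : cells lam = insert (i, j) (cells tau)) :
    nStat lam = i + nStat tau := by
  rw [nStat_eq_sum_cells, nStat_eq_sum_cells, h, Finset.sum_insert hij]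

theorem nStatConj_eq_add {n : ℕ} {lam : n.Partition} {tau : (n - 1).Partition} {i j : ℕ}
    (hij : (i, j) ∉ cells tau) (h : cells lam = insert (i, j) (cells tau)) :
    nStatConj lam = j + nStatConj tau := by
  rw [nStatConj_eq_sum_cells, nStatConj_eq_sum_cells, h, Finset.sum_insert hij]

theorem exists_common_subdiagram (α : ℝ) {n : ℕ} {lam rho : n.Partition} (hM : M α lam rho ≠ 0) :
    ∃ tau : (n - 1).Partition, cells tau ⊆ cells lam ∧ cells tau ⊆ cells rho := by
  by_contra! h
  refine hM (mul_eq_zero_of_right _ (Finset.sum_eq_zero fun tau _ => ?_))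
  by_cases hlam : cells tau ⊆ cells lam
  · simp [psi', h tau hlam]
  · simp [psi', hlam]

theorem lt_rowLen_zero {n : ℕ} (lam : n.Partition) {i j : ℕ} (h : (i, j) ∈ cells lam) :
    j < rowLen lam 0 := by
  rw [lt_rowLen_iff, ← mem_cells_iff]
  exact mem_cells_of_le lam h (Nat.zero_le i) le_rfl

theorem lt_colLen_zero {n : ℕ} (lam : n.Partition) {i j : ℕ} (h : (i, j) ∈ cells lam) :
    i < colLen lam 0 := by
  rw [← mem_cells_iff]
  exact mem_cells_of_le lam h le_rfl (Nat.zero_le j)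

/-- A cell whose removal from one diagram leaves a subdiagram of `lam` exceeds `lam` by at most
one row and one column. -/
theorem le_rowLen_zero_and_le_colLen_zero {n : ℕ} {lam rho : n.Partition}
    {tau : (n - 1).Partition} {i j : ℕ} (hlam : cells tau ⊆ cells lam)
    (h : cells rho = insert (i, j) (cells tau)) :
    j ≤ rowLen lam 0 ∧ i ≤ colLen lam 0 := by
  have hmem : (i, j) ∈ cells rho := h ▸ Finset.mem_insert_self _ _
  have mem_lam : ∀ {k l}, k ≤ i → l ≤ j → (k, l) ≠ (i, j) → (k, l) ∈ cells lam :=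
    fun hk hl hne => hlam (Finset.mem_of_mem_insert_of_ne
      (h ▸ mem_cells_of_le rho hmem hk hl) hne)
  constructor
  · obtain _ | j := j
    · exact Nat.zero_le _
    · exact lt_rowLen_zero lam (mem_lam le_rfl j.le_succ (by simp))
  · obtain _ | i := i
    · exact Nat.zero_le _
    · exact lt_colLen_zero lam (mem_lam i.le_succ le_rfl (by simp))

/-- If `λ ≠ ρ` and `M_α(λ,ρ) ≠ 0` then `|W_α(ρ) - W_α(λ)|` is at most
`(α(λ₁+1) + λ₁' + 1)/√(α C(n,2))`. -/
theorem W_diff_bound_of_M_ne_zero (α : ℝ) (hα : 1 ≤ α) (n : ℕ) (hn : 2 ≤ n)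
    (lam rho : n.Partition) (hne : lam ≠ rho) (hM : M α lam rho ≠ 0) :
    |W α rho - W α lam| ≤
      (α * ((rowLen lam 0 : ℝ) + 1) + (colLen lam 0 : ℝ) + 1) /
        Real.sqrt (α * n.choose 2) := by
  obtain ⟨tau, hlam, hrho⟩ := exists_common_subdiagram α hM
  obtain ⟨i, j, hij, hcl⟩ := exists_cells_eq_insert (by omega) lam tau hlam
  obtain ⟨i', j', hij', hcr⟩ := exists_cells_eq_insert (by omega) rho tau hrho
  obtain ⟨hj, hi⟩ := le_rowLen_zero_and_le_colLen_zero hlam hcl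
  obtain ⟨hj', hi'⟩ := le_rowLen_zero_and_le_colLen_zero hlam hcr
  rw [W, W, ← sub_div, abs_div, abs_of_nonneg (Real.sqrt_nonneg _)]
  refine div_le_div_of_nonneg_right ?_ (Real.sqrt_nonneg _)
  rw [nStat_eq_add hij hcl, nStatConj_eq_add hij hcl, nStat_eq_add hij' hcr,
    nStatConj_eq_add hij' hcr]
  push_cast
  have hα0 : 0 ≤ α := zero_le_one.trans hα
  have hαj : α * j ≤ α * rowLen lam 0 := by gcongr
  have hαj' : α * j' ≤ α * rowLen lam 0 := by gcongr
  have hαj0 : 0 ≤ α * j := by positivity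
  have hαj0' : 0 ≤ α * j' := by positivity
  have hiR : (i : ℝ) ≤ colLen lam 0 := by exact_mod_cast hi
  have hiR' : (i' : ℝ) ≤ colLen lam 0 := by exact_mod_cast hi'
  have hi0 : (0 : ℝ) ≤ i := by positivity
  have hi0' : (0 : ℝ) ≤ i' := by positivity
  rw [abs_le]
  constructor <;> linarith

end JackTest
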